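/- arXiv:2602.02997 — 2 statements merged into one kernel-verified Lean document; each statement's English description precedes it below -/
import Mathlib

section
/- Let μ be a Borel measure on Euclidean space ℝ⁴, let x₀ ∈ ℝ⁴ and Θ ≥ 0, and suppose that μ(B_ρ(x₀)) ≤ Θ·π·ρ² for every radius ρ > 0, where B_ρ(x₀) is the closed ball of radius ρ about x₀. Then for all radii 0 < r ≤ R, the integral ∫_{B_R(x₀) \ B_r(x₀)} ‖y − x₀‖⁻² dμ(y) is at most 16·π·Θ·(1 + log(R/r)). -/
open MeasureTheory Real

section DyadicAnnuli

variable {E : Type*} [SeminormedAddCommGroup E] [MeasurableSpace E] [OpensMeasurableSpace E]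
  {μ : Measure E} {x₀ : E} {C : ℝ}

/-- Under quadratic growth, the integral of `‖y - x₀‖⁻²` over a single dyadic annulus is bounded
independently of the radius. -/
lemma setLIntegral_inv_sq_dyadic_annulus_le
    (hμ : ∀ ρ : ℝ, 0 < ρ → μ (Metric.closedBall x₀ ρ) ≤ ENNReal.ofReal (C * ρ ^ 2))
    {s : ℝ} (hs : 0 < s) :
    ∫⁻ y in Metric.closedBall x₀ (2 * s) \ Metric.closedBall x₀ s,
        ENNReal.ofReal ((‖y - x₀‖ ^ 2)⁻¹) ∂μ ≤ ENNReal.ofReal (4 * C) := by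
  calc ∫⁻ y in Metric.closedBall x₀ (2 * s) \ Metric.closedBall x₀ s,
        ENNReal.ofReal ((‖y - x₀‖ ^ 2)⁻¹) ∂μ
      ≤ ∫⁻ _ in Metric.closedBall x₀ (2 * s) \ Metric.closedBall x₀ s,
        ENNReal.ofReal ((s ^ 2)⁻¹) ∂μ := by
        refine setLIntegral_mono' (Metric.isClosed_closedBall.measurableSet.diff
          Metric.isClosed_closedBall.measurableSet) fun y hy ↦ ?_
        have hsy : s < ‖y - x₀‖ := by
          simpa [Metric.mem_closedBall, dist_eq_norm] using hy.2
        gcongr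
    _ = ENNReal.ofReal ((s ^ 2)⁻¹) *
          μ (Metric.closedBall x₀ (2 * s) \ Metric.closedBall x₀ s) := setLIntegral_const _ _
    _ ≤ ENNReal.ofReal ((s ^ 2)⁻¹) * ENNReal.ofReal (C * (2 * s) ^ 2) := by
        gcongr
        exact (measure_mono Set.sdiff_subset).trans (hμ _ (by positivity))
    _ = ENNReal.ofReal (4 * C) := by
        rw [← ENNReal.ofReal_mul (by positivity)]
        congr 1
        field_simp
        ring

/-- Under quadratic growth, the integral of `‖y - x₀‖⁻²` over a union of `N` consecutive dyadic
annuli grows at most linearly in `N`. -/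
lemma setLIntegral_inv_sq_annulus_two_pow_le
    (hμ : ∀ ρ : ℝ, 0 < ρ → μ (Metric.closedBall x₀ ρ) ≤ ENNReal.ofReal (C * ρ ^ 2))
    {r : ℝ} (hr : 0 < r) (N : ℕ) :
    ∫⁻ y in Metric.closedBall x₀ (2 ^ N * r) \ Metric.closedBall x₀ r,
        ENNReal.ofReal ((‖y - x₀‖ ^ 2)⁻¹) ∂μ ≤ N * ENNReal.ofReal (4 * C) := by
  induction N with
  | zero => simp
  | succ N ih =>
    have hsub : Metric.closedBall x₀ (2 ^ (N + 1) * r) \ Metric.closedBall x₀ r ⊆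
        (Metric.closedBall x₀ (2 ^ N * r) \ Metric.closedBall x₀ r) ∪
          (Metric.closedBall x₀ (2 * (2 ^ N * r)) \ Metric.closedBall x₀ (2 ^ N * r)) := by
      rw [show (2 : ℝ) ^ (N + 1) * r = 2 * (2 ^ N * r) by ring]
      intro y hy
      by_cases h : y ∈ Metric.closedBall x₀ (2 ^ N * r)
      · exact Or.inl ⟨h, hy.2⟩
      · exact Or.inr ⟨hy.1, h⟩
    refine (lintegral_mono_set hsub).trans ((lintegral_union_le _ _ _).trans ?_)
    rw [Nat.cast_succ, add_mul, one_mul]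
    exact add_le_add ih (setLIntegral_inv_sq_dyadic_annulus_le hμ (by positivity))

end DyadicAnnuli

/-- A real number `t ≥ 1` is at most `2 ^ N` for some `N` bounded in terms of `log t`. -/
lemma exists_le_two_pow_of_one_le {t : ℝ} (ht : 1 ≤ t) :
    ∃ N : ℕ, t ≤ 2 ^ N ∧ (N : ℝ) ≤ 1 + 2 * Real.log t := by
  have hlog : 0 ≤ Real.log t := Real.log_nonneg ht
  have hlog2 := Real.log_two_gt_d9
  have hlog2_pos : 0 < Real.log 2 := by linarith
  refine ⟨⌈Real.log t / Real.log 2⌉₊, ?_, ?_⟩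
  · rw [← Real.log_le_log_iff (by linarith) (by positivity), Real.log_pow,
      ← div_le_iff₀ hlog2_pos]
    exact Nat.le_ceil _
  · have hceil := Nat.ceil_lt_add_one (div_nonneg hlog hlog2_pos.le)
    have hdiv : Real.log t / Real.log 2 ≤ 2 * Real.log t := by
      rw [div_le_iff₀ hlog2_pos]
      nlinarith
    linarith

/-- If a Borel measure `μ` on `ℝ⁴` satisfies the quadratic area growth bound
`μ(B_ρ(x₀)) ≤ Θ·π·ρ²` for every `ρ > 0`, then for all `0 < r ≤ R` the integral of
`‖y - x₀‖⁻²` over the annulus `B_R(x₀) \ B_r(x₀)` is at most `16·π·Θ·(1 + log (R/r))`. -/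
theorem annulus_integral_bound_of_quadratic_growth
    (μ : Measure (EuclideanSpace ℝ (Fin 4))) (x₀ : EuclideanSpace ℝ (Fin 4))
    (Θ : ℝ) (hΘ : 0 ≤ Θ)
    (hμ : ∀ ρ : ℝ, 0 < ρ →
      μ (Metric.closedBall x₀ ρ) ≤ ENNReal.ofReal (Θ * π * ρ ^ 2))
    (r R : ℝ) (hr : 0 < r) (hrR : r ≤ R) :
    ∫⁻ y in Metric.closedBall x₀ R \ Metric.closedBall x₀ r,
        ENNReal.ofReal ((‖y - x₀‖ ^ 2)⁻¹) ∂μ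
      ≤ ENNReal.ofReal (16 * π * Θ * (1 + Real.log (R / r))) := by
  obtain ⟨N, hN, hNlog⟩ := exists_le_two_pow_of_one_le ((one_le_div hr).2 hrR)
  have hsub : Metric.closedBall x₀ R \ Metric.closedBall x₀ r ⊆
      Metric.closedBall x₀ (2 ^ N * r) \ Metric.closedBall x₀ r :=
    Set.sdiff_subset_sdiff_left (Metric.closedBall_subset_closedBall ((div_le_iff₀ hr).1 hN))
  refine (lintegral_mono_set hsub).trans
    ((setLIntegral_inv_sq_annulus_two_pow_le hμ hr N).trans ?_)
  rw [← ENNReal.ofReal_natCast, ← ENNReal.ofReal_mul N.cast_nonneg]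
  apply ENNReal.ofReal_le_ofReal
  have hlog : 0 ≤ Real.log (R / r) := Real.log_nonneg ((one_le_div hr).2 hrR)
  have hC : 0 ≤ Θ * π := by positivity
  calc (N : ℝ) * (4 * (Θ * π)) ≤ (4 * (1 + Real.log (R / r))) * (4 * (Θ * π)) := by
        gcongr
        linarith
    _ = 16 * π * Θ * (1 + Real.log (R / r)) := by ring
end

section
/- Let p be a polynomial in two complex variables with total degree d ≥ 1, and let p_d denote its homogeneous component of degree d (its leading form). Suppose v ∈ ℂ² is a unit vector with p_d(v) = 0. Then for every ε > 0 and every R > 0 there exists x ∈ ℂ² with p(x) = 0, ‖x‖ > R, and ‖x/‖x‖ − λ·v‖ < ε for some λ ∈ ℂ with |λ| = 1. -/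
open Polynomial in
/-- If the constant coefficient of a complex polynomial is small compared to its leading
coefficient, then the polynomial has a small root. -/
theorem Polynomial.exists_root_norm_lt (f : ℂ[X]) (δ : ℝ) (hδ : 0 ≤ δ)
    (h : ‖f.coeff 0‖ < ‖f.leadingCoeff‖ * δ ^ f.natDegree) :
    ∃ s : ℂ, f.eval s = 0 ∧ ‖s‖ < δ := by
  by_contra! hroots
  have hprod : ∀ m : Multiset ℂ, (∀ s ∈ m, δ ≤ ‖s‖) → δ ^ m.card ≤ ‖m.prod‖ := by
    intro m
    induction m using Multiset.induction_on with
    | empty => simp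
    | cons a m ih =>
      intro hm
      rw [Multiset.card_cons, pow_succ', Multiset.prod_cons, norm_mul]
      exact mul_le_mul (hm a (by simp)) (ih fun s hs ↦ hm s (by simp [hs]))
        (by positivity) (norm_nonneg _)
  have hf : f.Splits := IsAlgClosed.splits f
  rw [hf.coeff_zero_eq_leadingCoeff_mul_prod_roots] at h
  simp only [norm_mul, norm_pow, norm_neg, norm_one, one_pow, one_mul] at h
  refine h.not_ge (mul_le_mul_of_nonneg_left ?_ (norm_nonneg _))
  rw [hf.natDegree_eq_card_roots]
  exact hprod _ fun s hs ↦ hroots s (Polynomial.isRoot_of_mem_roots hs)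

open Polynomial in
/-- A complex polynomial of degree less than `d` is `o(|z|^d)` along the positive reals. -/
theorem Polynomial.eventually_norm_eval_lt (f : ℂ[X]) (d : ℕ) (hf : f.degree < d)
    (κ : ℝ) (hκ : 0 < κ) :
    ∀ᶠ t : ℝ in Filter.atTop, ‖f.eval (t : ℂ)‖ < κ * t ^ d := by
  have hlim : Filter.Tendsto (fun t : ℝ ↦ ∑ i ∈ Finset.range d, ‖f.coeff i‖ * (t ^ i / t ^ d))
      Filter.atTop (nhds (∑ i ∈ Finset.range d, ‖f.coeff i‖ * 0)) :=
    tendsto_finsetSum _ fun i hi ↦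
      (tendsto_pow_div_pow_atTop_zero (Finset.mem_range.1 hi)).const_mul _
  simp only [mul_zero, Finset.sum_const_zero] at hlim
  filter_upwards [hlim.eventually_lt_const hκ, Filter.eventually_gt_atTop 0] with t ht ht0
  have htd : 0 < t ^ d := by positivity
  rw [← div_lt_iff₀ htd]
  refine lt_of_le_of_lt ?_ ht
  have heval : f.eval (t : ℂ) = ∑ i ∈ Finset.range d, f.coeff i * (t : ℂ) ^ i := by
    by_cases hf0 : f = 0
    · simp [hf0]
    · exact Polynomial.eval_eq_sum_range' ((Polynomial.natDegree_lt_iff_degree_lt hf0).2 hf) _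
  rw [heval, div_le_iff₀ htd, Finset.sum_mul]
  refine (norm_sum_le _ _).trans (Finset.sum_le_sum fun i _ ↦ ?_)
  rw [norm_mul, norm_pow, Complex.norm_of_nonneg ht0.le, mul_assoc, div_mul_cancel₀ _ htd.ne']

/-- Restricting a polynomial of total degree at most `d` to the line `s ↦ a + s b` gives a
univariate polynomial of degree at most `d`. -/
theorem MvPolynomial.natDegree_aeval_line_le {σ R : Type*} [CommRing R]
    (p : MvPolynomial σ R) (d : ℕ) (hd : p.totalDegree ≤ d) (a b : σ → R) :
    (aeval (fun i ↦ Polynomial.C (a i) + Polynomial.C (b i) * Polynomial.X) p).natDegree ≤ d := by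
  simpa using MvPolynomial.aeval_natDegree_le p hd
    (fun i ↦ Polynomial.C (a i) + Polynomial.C (b i) * Polynomial.X) (n := 1)
    fun i ↦ by compute_degree

/-- The coefficient of degree `d` of the restriction of a polynomial of total degree at most `d`
to the line `s ↦ a + s b` is the value at `b` of the homogeneous component of degree `d`. -/
theorem MvPolynomial.coeff_aeval_line {σ R : Type*} [CommRing R]
    (p : MvPolynomial σ R) (d : ℕ) (hd : p.totalDegree ≤ d) (a b : σ → R) :
    (aeval (fun i ↦ Polynomial.C (a i) + Polynomial.C (b i) * Polynomial.X) p).coeff d =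
      eval b (homogeneousComponent d p) := by
  have hmon : ∀ m : σ →₀ ℕ,
      (aeval (fun i ↦ Polynomial.C (a i) + Polynomial.C (b i) * Polynomial.X)
        (monomial m (1 : R))).coeff m.degree = eval b (monomial m (1 : R)) := by
    intro m
    induction m using Finsupp.induction_linear with
    | zero => simp
    | add m n hm hn =>
      have hmn : monomial (m + n) (1 : R) = monomial m 1 * monomial n 1 := by
        rw [monomial_mul, one_mul]
      rw [hmn, map_mul, map_mul, map_add,
        Polynomial.coeff_mul_add_eq_of_natDegree_le (df := m.degree) (dg := n.degree)
        (natDegree_aeval_line_le _ _ (totalDegree_monomial_le m 1) a b)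
        (natDegree_aeval_line_le _ _ (totalDegree_monomial_le n 1) a b), hm, hn]
    | single i k =>
      have hpow := Polynomial.coeff_pow_of_natDegree_le (m := k) (n := 1)
        (p := Polynomial.C (a i) + Polynomial.C (b i) * Polynomial.X) (by compute_degree)
      simpa [aeval_monomial, eval_monomial] using hpow
  have hlow : ∀ m ∈ p.support, m.degree ≠ d →
      (aeval (fun i ↦ Polynomial.C (a i) + Polynomial.C (b i) * Polynomial.X)
        (monomial m (1 : R))).coeff d = 0 := fun m hm hmd ↦
    Polynomial.coeff_eq_zero_of_natDegree_lt <|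
      (natDegree_aeval_line_le _ _ (totalDegree_monomial_le m 1) a b).trans_lt <|
        lt_of_le_of_ne ((le_totalDegree hm).trans hd) hmd
  have hsmul : ∀ m, monomial m (coeff m p) = coeff m p • monomial m (1 : R) := fun m ↦ by
    rw [smul_monomial, smul_eq_mul, mul_one]
  rw [homogeneousComponent_apply, Finset.sum_filter]
  conv_lhs => rw [p.as_sum]
  simp only [map_sum, Polynomial.finsetSum_coeff]
  refine Finset.sum_congr rfl fun m hm ↦ ?_
  rw [hsmul, map_smul, Polynomial.coeff_smul]
  split_ifs with hmd
  · rw [← hmd, hmon, smul_eval, smul_eq_mul]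
  · rw [hlow m hm hmd, smul_zero, map_zero]

/-- The restriction of a polynomial to the line `s ↦ a + s b` has the expected values. -/
theorem MvPolynomial.eval_aeval_line {σ R : Type*} [CommRing R]
    (p : MvPolynomial σ R) (a b : σ → R) (s : R) :
    (aeval (fun i ↦ Polynomial.C (a i) + Polynomial.C (b i) * Polynomial.X) p).eval s =
      eval (fun i ↦ a i + b i * s) p := by
  induction p using MvPolynomial.induction_on with
  | C r => simp
  | add p q hp hq => simp [hp, hq]
  | mul_X p i hp => simp [hp]

/-- The leading form of a nonzero polynomial is nonzero. -/
theorem MvPolynomial.homogeneousComponent_totalDegree_ne_zero {σ R : Type*} [CommSemiring R]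
    (p : MvPolynomial σ R) (hp : p ≠ 0) : homogeneousComponent p.totalDegree p ≠ 0 := by
  obtain ⟨m, hm, hmd⟩ := p.support.exists_mem_eq_sup (support_nonempty.2 hp) (fun m ↦ m.degree)
  intro h
  have := congrArg (coeff m) h
  rw [coeff_homogeneousComponent, if_pos] at this
  · exact mem_support_iff.1 hm (by simpa using this)
  · exact hmd.symm

/-- A nonzero vector which is close to `t • v`, with `v` a unit vector, has a direction close
to `v`. -/
theorem norm_inv_norm_smul_sub_le {E : Type*} [NormedAddCommGroup E] [NormedSpace ℝ E]
    (x v : E) (hv : ‖v‖ = 1) (t e : ℝ) (ht : 0 < t) (he : e ≤ 1 / 2) (h : ‖x - t • v‖ ≤ e * t) :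
    t / 2 ≤ ‖x‖ ∧ ‖‖x‖⁻¹ • x - v‖ ≤ 4 * e := by
  have htv : ‖t • v‖ = t := by rw [norm_smul, hv, mul_one, Real.norm_of_nonneg ht.le]
  have hdiff : |‖x‖ - t| ≤ e * t := by
    simpa only [htv] using (abs_norm_sub_norm_le x (t • v)).trans h
  have hx : t / 2 ≤ ‖x‖ := by nlinarith [abs_le.1 hdiff]
  have hx0 : 0 < ‖x‖ := by linarith
  refine ⟨hx, ?_⟩
  have heq : ‖x‖⁻¹ • x - v = ‖x‖⁻¹ • ((x - t • v) - (‖x‖ - t) • v) := by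
    rw [sub_smul, sub_sub_sub_cancel_right, smul_sub, inv_smul_smul₀ hx0.ne']
  have hnum : ‖(x - t • v) - (‖x‖ - t) • v‖ ≤ 2 * (e * t) := by
    refine (norm_sub_le _ _).trans ?_
    rw [norm_smul, hv, mul_one, Real.norm_eq_abs]
    linarith
  have he0 : 0 ≤ e := by nlinarith [norm_nonneg (x - t • v)]
  rw [heq, norm_smul, norm_inv, norm_norm, inv_mul_le_iff₀ hx0]
  nlinarith

/-- Every unit zero direction `v` of the leading form of a polynomial `p` on `ℂ²` of total
degree `d ≥ 1` is attained, up to a unit complex scalar, as a limit of directions of points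
of the affine curve `{p = 0}` going to infinity: for every `ε > 0` and `R > 0` there is a
zero `x` of `p` with `‖x‖ > R` whose direction `x/‖x‖` is `ε`-close to `λ·v` for some
unimodular `λ ∈ ℂ`. -/
theorem zero_direction_of_leadingForm_is_attained
    (p : MvPolynomial (Fin 2) ℂ) (d : ℕ) (hd : p.totalDegree = d) (hd1 : 1 ≤ d)
    (v : EuclideanSpace ℂ (Fin 2)) (hv : ‖v‖ = 1)
    (hvzero : MvPolynomial.eval v (MvPolynomial.homogeneousComponent d p) = 0) :
    ∀ ε > (0 : ℝ), ∀ R > (0 : ℝ), ∃ x : EuclideanSpace ℂ (Fin 2),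
      MvPolynomial.eval x p = 0 ∧ ‖x‖ > R ∧
      ∃ lam : ℂ, ‖lam‖ = 1 ∧ ‖(‖x‖)⁻¹ • x - lam • v‖ < ε := by
  intro ε hε R hR
  have hp : p ≠ 0 := by
    rintro rfl
    simp at hd
    omega
  obtain ⟨b, hb⟩ : ∃ b, MvPolynomial.eval b (MvPolynomial.homogeneousComponent d p) ≠ 0 := by
    by_contra! h
    exact p.homogeneousComponent_totalDegree_ne_zero hp
      (MvPolynomial.funext fun x ↦ by simpa [hd] using h x)
  set c := MvPolynomial.eval b (MvPolynomial.homogeneousComponent d p) with hc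
  let w : EuclideanSpace ℂ (Fin 2) := WithLp.toLp 2 b
  obtain ⟨e, he0, he⟩ := exists_between (lt_min (by norm_num : (0 : ℝ) < 1 / 2)
    (by positivity : 0 < ε / 4))
  rw [lt_min_iff] at he
  let η : ℝ := e / (‖w‖ + 1)
  have hη : 0 < η := by positivity
  have hηw : η * ‖w‖ ≤ e := by
    rw [div_mul_eq_mul_div, div_le_iff₀ (by positivity)]
    nlinarith
  let g := MvPolynomial.aeval
    (fun i ↦ Polynomial.C ((0 : Fin 2 → ℂ) i) + Polynomial.C (v i) * Polynomial.X) p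
  have hg : g.degree < d := by
    refine lt_of_le_of_ne (Polynomial.degree_le_of_natDegree_le
      (p.natDegree_aeval_line_le d hd.le 0 v)) fun h ↦ ?_
    exact Polynomial.coeff_ne_zero_of_eq_degree h ((p.coeff_aeval_line d hd.le 0 v).trans hvzero)
  have hlarge := g.eventually_norm_eval_lt d hg (‖c‖ * η ^ d) (by positivity)
  obtain ⟨t, htg, htR⟩ := (hlarge.and (Filter.eventually_gt_atTop (2 * R))).exists
  have ht : 0 < t := by linarith
  let f := MvPolynomial.aeval
    (fun i ↦ Polynomial.C ((t : ℂ) * v i) + Polynomial.C (b i) * Polynomial.X) p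
  have hfd : f.coeff d = c := p.coeff_aeval_line d hd.le _ b
  have hfnat : f.natDegree = d := Polynomial.natDegree_eq_of_le_of_coeff_ne_zero
    (p.natDegree_aeval_line_le d hd.le _ b) (hfd.trans_ne hb)
  have hf0 : f.coeff 0 = g.eval (t : ℂ) := by
    rw [Polynomial.coeff_zero_eq_eval_zero, MvPolynomial.eval_aeval_line,
      MvPolynomial.eval_aeval_line]
    simp [mul_comm]
  obtain ⟨s, hs0, hs⟩ := f.exists_root_norm_lt (η * t) (by positivity) (by
    rwa [Polynomial.leadingCoeff, hfnat, hfd, hf0, mul_pow, ← mul_assoc])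
  rw [MvPolynomial.eval_aeval_line] at hs0
  let x : EuclideanSpace ℂ (Fin 2) := t • v + s • w
  have hx : ‖x - t • v‖ ≤ e * t := by
    rw [add_sub_cancel_left, norm_smul]
    nlinarith [norm_nonneg w]
  obtain ⟨hxt, hxv⟩ := norm_inv_norm_smul_sub_le x v hv t e ht he.1.le hx
  refine ⟨x, ?_, by linarith, 1, norm_one, ?_⟩
  · rw [← hs0]
    congr 2
    funext i
    simp [x, w, mul_comm]
  · rw [one_smul]
    linarith
end
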